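/- arXiv:1910.11286 — 2 statements merged into one kernel-verified Lean document; each statement's English description precedes it below -/
import Mathlib

section
/- For all nonnegative integers m, n, and k, the cardinality of F(n,m;k) equals the number of sequences σ ∈ S(n,m) with inv(σ) = k. -/
open Finset

/-- Number of inversions of a sequence. -/
def invStat {n m : ℕ} (σ : Fin n → Fin m) : ℕ :=
  ((Finset.univ : Finset (Fin n × Fin n)).filter fun p => p.1 < p.2 ∧ σ p.2 < σ p.1).card

/-- The number of elements of the multisets of index less than `j`. -/
def cardBelow {m : ℕ} (F : Fin m → Multiset ℕ) (j : Fin m) : ℕ :=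
  ∑ i ∈ Finset.univ.filter (fun i => i < j), Multiset.card (F i)

/-- Every element of `F j` is bounded by the number of elements of the preceding multisets. -/
def IsFundamental {m : ℕ} (F : Fin m → Multiset ℕ) : Prop :=
  ∀ j : Fin m, ∀ x ∈ F j, x ≤ cardBelow F j

/-- Add to `F j` the largest element it may contain. -/
def pushMax {m : ℕ} (j : Fin m) (F : Fin m → Multiset ℕ) : Fin m → Multiset ℕ :=
  fun i => if i = j then cardBelow F j ::ₘ F i else F i

/-- The tuple of multisets of a sequence: the letter at a position contributes the number of
smaller letters to its right. -/
def toMultisets {m : ℕ} : (n : ℕ) → (Fin n → Fin m) → Fin m → Multiset ℕ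
  | 0, _ => fun _ => 0
  | n + 1, σ => pushMax (σ 0) (toMultisets n (Fin.tail σ))

lemma card_pushMax {m : ℕ} (j i : Fin m) (F : Fin m → Multiset ℕ) :
    Multiset.card (pushMax j F i) = Multiset.card (F i) + if i = j then 1 else 0 := by
  unfold pushMax
  split_ifs <;> simp

lemma sum_card_pushMax {m : ℕ} (j : Fin m) (F : Fin m → Multiset ℕ) :
    ∑ i, Multiset.card (pushMax j F i) = (∑ i, Multiset.card (F i)) + 1 := by
  simp [card_pushMax, Finset.sum_add_distrib]

lemma sum_sum_pushMax {m : ℕ} (j : Fin m) (F : Fin m → Multiset ℕ) :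
    ∑ i, (pushMax j F i).sum = (∑ i, (F i).sum) + cardBelow F j := by
  have h : ∀ i, (pushMax j F i).sum = (F i).sum + if i = j then cardBelow F j else 0 := by
    intro i
    unfold pushMax
    split_ifs <;> simp [add_comm]
  simp [h, Finset.sum_add_distrib]

lemma cardBelow_pushMax {m : ℕ} (j i : Fin m) (F : Fin m → Multiset ℕ) :
    cardBelow (pushMax j F) i = cardBelow F i + if j < i then 1 else 0 := by
  simp [cardBelow, card_pushMax, Finset.sum_add_distrib]

lemma IsFundamental.pushMax {m : ℕ} {F : Fin m → Multiset ℕ} (hF : IsFundamental F)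
    (j : Fin m) : IsFundamental (pushMax j F) := by
  intro i x hx
  rw [cardBelow_pushMax]
  by_cases h : i = j
  · subst h
    simp only [_root_.pushMax, if_true, Multiset.mem_cons] at hx
    rcases hx with rfl | hx
    · simp
    · exact (hF i x hx).trans (Nat.le_add_right _ _)
  · simp only [_root_.pushMax, if_neg h] at hx
    exact (hF i x hx).trans (Nat.le_add_right _ _)

lemma not_lt_of_pushMax_eq {m : ℕ} {j j' : Fin m} {F F' : Fin m → Multiset ℕ}
    (hF : IsFundamental F) (h : pushMax j F = pushMax j' F') : ¬ j < j' := by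
  intro hlt
  have h1 : cardBelow F' j' ∈ pushMax j F j' := by
    rw [h]
    simp [pushMax]
  have h2 := cardBelow_pushMax j j' F
  rw [h, cardBelow_pushMax] at h2
  simp only [lt_irrefl, if_false, if_pos hlt] at h2
  simp only [pushMax, if_neg hlt.ne'] at h1
  have := hF _ _ h1
  omega

lemma pushMax_inj {m : ℕ} {j j' : Fin m} {F F' : Fin m → Multiset ℕ}
    (hF : IsFundamental F) (hF' : IsFundamental F') (h : pushMax j F = pushMax j' F') :
    j = j' ∧ F = F' := by
  obtain rfl : j = j' := le_antisymm (not_lt.1 (not_lt_of_pushMax_eq hF' h.symm))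
    (not_lt.1 (not_lt_of_pushMax_eq hF h))
  refine ⟨rfl, funext fun i => ?_⟩
  have hc := congrArg (cardBelow · j) h
  simp only [cardBelow_pushMax, lt_irrefl, if_false, add_zero] at hc
  have hi := congrFun h i
  unfold pushMax at hi
  split_ifs at hi
  · rw [hc] at hi
    exact (Multiset.cons_inj_right _).1 hi
  · exact hi

lemma exists_pushMax_eq {m n : ℕ} {F : Fin m → Multiset ℕ} (hF : IsFundamental F)
    (hn : ∑ i, Multiset.card (F i) = n + 1) :
    ∃ j G, IsFundamental G ∧ pushMax j G = F := by
  let S : Finset (Fin m) := Finset.univ.filter fun j => cardBelow F j ∈ F j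
  let T : Finset (Fin m) := Finset.univ.filter fun j => F j ≠ 0
  have hT : T.Nonempty := by
    by_contra h
    rw [Finset.not_nonempty_iff_eq_empty] at h
    have h0 : ∀ i, F i = 0 := by simpa [T, Finset.filter_eq_empty_iff] using h
    simp [h0] at hn
  have hS : S.Nonempty := by
    refine ⟨T.min' hT, ?_⟩
    have hmem := T.min'_mem hT
    have h0 : cardBelow F (T.min' hT) = 0 := by
      refine Finset.sum_eq_zero fun i hi => ?_
      by_contra hne
      have hiT : i ∈ T := by simpa [T] using hne
      exact absurd (T.min'_le i hiT) (not_le.2 (Finset.mem_filter.1 hi).2)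
    obtain ⟨x, hx⟩ := Multiset.exists_mem_of_ne_zero (Finset.mem_filter.1 hmem).2
    have hx0 := hF _ x hx
    rw [h0, Nat.le_zero] at hx0
    simp only [S, Finset.mem_filter, Finset.mem_univ, true_and]
    rw [h0]
    exact hx0 ▸ hx
  obtain ⟨j, hj, hmax⟩ : ∃ j ∈ S, ∀ i ∈ S, i ≤ j :=
    ⟨S.max' hS, S.max'_mem hS, fun i hi => S.le_max' i hi⟩
  replace hj : cardBelow F j ∈ F j := (Finset.mem_filter.1 hj).2
  let G : Fin m → Multiset ℕ := fun i => if i = j then (F i).erase (cardBelow F j) else F i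
  have hGj : cardBelow G j = cardBelow F j := by
    refine Finset.sum_congr rfl fun i hi => ?_
    simp [G, (Finset.mem_filter.1 hi).2.ne]
  have hGF : pushMax j G = F := by
    funext i
    by_cases h : i = j
    · subst h
      simp only [pushMax, hGj]
      simp [G, Multiset.cons_erase hj]
    · simp [pushMax, G, h]
  refine ⟨j, G, fun i x hx => ?_, hGF⟩
  have hb := cardBelow_pushMax j i G
  rw [hGF] at hb
  have hxF : x ∈ F i := by
    by_cases h : i = j
    · simp only [G, if_pos h] at hx
      exact Multiset.mem_of_mem_erase hx
    · simpa [G, h] using hx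
  have hle := hF i x hxF
  by_cases hlt : j < i
  · have hne : x ≠ cardBelow F i := by
      rintro rfl
      exact absurd (hmax i (by simpa [S] using hxF)) (not_le.2 hlt)
    rw [if_pos hlt] at hb
    omega
  · rw [if_neg hlt] at hb
    omega

lemma isFundamental_toMultisets {m : ℕ} :
    ∀ (n : ℕ) (σ : Fin n → Fin m), IsFundamental (toMultisets n σ)
  | 0, _ => by simp [IsFundamental, toMultisets]
  | n + 1, σ => (isFundamental_toMultisets n (Fin.tail σ)).pushMax (σ 0)

lemma sum_card_toMultisets {m : ℕ} :
    ∀ (n : ℕ) (σ : Fin n → Fin m), ∑ i, Multiset.card (toMultisets n σ i) = n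
  | 0, _ => by simp [toMultisets]
  | n + 1, σ => by rw [toMultisets, sum_card_pushMax, sum_card_toMultisets n]

lemma cardBelow_toMultisets {m : ℕ} (j : Fin m) :
    ∀ (n : ℕ) (σ : Fin n → Fin m),
      cardBelow (toMultisets n σ) j = ∑ i, if σ i < j then 1 else 0
  | 0, _ => by simp [toMultisets, cardBelow]
  | n + 1, σ => by
    rw [toMultisets, cardBelow_pushMax, cardBelow_toMultisets j n, Fin.sum_univ_succ, add_comm]
    rfl

lemma invStat_eq_sum {n m : ℕ} (σ : Fin n → Fin m) :
    invStat σ = ∑ a, ∑ b, if a < b ∧ σ b < σ a then 1 else 0 := by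
  rw [invStat, Finset.card_filter, Fintype.sum_prod_type]

lemma invStat_succ {n m : ℕ} (σ : Fin (n + 1) → Fin m) :
    invStat σ = invStat (Fin.tail σ) + ∑ i, if Fin.tail σ i < σ 0 then 1 else 0 := by
  simp only [invStat_eq_sum, Fin.sum_univ_succ, Fin.tail, Fin.succ_lt_succ_iff, Fin.succ_pos,
    Fin.not_lt_zero, false_and, true_and, if_false, zero_add]
  rw [add_comm]
  congr!

lemma sum_sum_toMultisets {m : ℕ} :
    ∀ (n : ℕ) (σ : Fin n → Fin m), ∑ i, (toMultisets n σ i).sum = invStat σ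
  | 0, σ => by simp [toMultisets, invStat_eq_sum]
  | n + 1, σ => by
    rw [toMultisets, sum_sum_pushMax, sum_sum_toMultisets n, cardBelow_toMultisets, invStat_succ]

lemma toMultisets_injective {m : ℕ} :
    ∀ n : ℕ, Function.Injective (toMultisets (m := m) n)
  | 0 => fun _ _ _ => Subsingleton.elim _ _
  | n + 1 => fun σ τ h => by
    obtain ⟨h0, ht⟩ := pushMax_inj (isFundamental_toMultisets n _)
      (isFundamental_toMultisets n _) h
    rw [← Fin.cons_self_tail σ, ← Fin.cons_self_tail τ, h0, toMultisets_injective n ht]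

lemma exists_toMultisets_eq {m : ℕ} :
    ∀ (n : ℕ) (F : Fin m → Multiset ℕ), IsFundamental F → ∑ i, Multiset.card (F i) = n →
      ∃ σ, toMultisets n σ = F
  | 0, F, _, hn => by
    refine ⟨Fin.elim0, funext fun i => ?_⟩
    have hi := Finset.sum_eq_zero_iff.1 hn i (Finset.mem_univ i)
    exact (Multiset.card_eq_zero.1 hi).symm
  | n + 1, F, hF, hn => by
    obtain ⟨j, G, hG, rfl⟩ := exists_pushMax_eq hF hn
    rw [sum_card_pushMax] at hn
    obtain ⟨σ, rfl⟩ := exists_toMultisets_eq n G hG (Nat.succ_injective hn)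
    exact ⟨Fin.cons j σ, by simp [toMultisets]⟩

/-- the cardinality of `F(n,m;k)` (fundamental sequences in the fundamental
Mahonian set `F(n,m)` whose elements sum, with multiplicity, to `k`) equals the number of
sequences `σ ∈ S(n,m)` with `inv(σ) = k`. -/
theorem stmt3 (m n k : ℕ) :
    Nat.card {F : Fin m → Multiset ℕ //
        (∑ j, Multiset.card (F j)) = n ∧
        (∀ j : Fin m, ∀ x ∈ F j, x ≤ ∑ i ∈ Finset.univ.filter (fun i => i < j),
          Multiset.card (F i)) ∧
        (∑ j, (F j).sum) = k}
    = ((Finset.univ : Finset (Fin n → Fin m)).filter fun σ => invStat σ = k).card := by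
  rw [← Fintype.card_subtype, ← Nat.card_eq_fintype_card]
  symm
  refine Nat.card_congr (Equiv.ofBijective
    (fun σ => ⟨toMultisets n σ.1, sum_card_toMultisets n σ.1, isFundamental_toMultisets n σ.1,
      (sum_sum_toMultisets n σ.1).trans σ.2⟩) ⟨fun σ τ h => ?_, ?_⟩)
  · exact Subtype.ext (toMultisets_injective n (congrArg Subtype.val h))
  · rintro ⟨F, hn, hF, hk⟩
    obtain ⟨σ, rfl⟩ := exists_toMultisets_eq n F hF hn
    exact ⟨⟨σ, (sum_sum_toMultisets n σ).symm.trans hk⟩, rfl⟩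
end

section
/- Let n and k be nonnegative integers with n ≥ k. Then |{σ ∈ S(n+1, 2) : maj(σ) = k}| − |{σ ∈ S(n, 2) : maj(σ) = k}| = part(k); that is, the coefficient of q^k in the difference of Galois numbers G(n+1, 2) − G(n, 2) equals the number of integer partitions of k. -/
open Finset

/-- The major index of a sequence `σ`: the sum of the (1-based) positions `a` such that
`σ_a > σ_{a+1}`. -/
def majStat {n m : ℕ} (σ : Fin n → Fin m) : ℕ :=
  ∑ a : Fin n,
    if h : (a : ℕ) + 1 < n then
      (if σ ⟨(a : ℕ) + 1, h⟩ < σ a then (a : ℕ) + 1 else 0)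
    else 0

open Polynomial

/-- The Gaussian binomial coefficient `[i + c choose c]`: the generating polynomial of partitions
with at most `i` parts, all of them at most `c`. -/
noncomputable def gaussPoly : ℕ → ℕ → ℤ[X]
  | 0, _ => 1
  | _ + 1, 0 => 1
  | i + 1, c + 1 => gaussPoly (i + 1) c + X ^ (c + 1) * gaussPoly i (c + 1)

lemma gaussPoly_zero_left (c : ℕ) : gaussPoly 0 c = 1 := by
  simp [gaussPoly]

lemma gaussPoly_zero_right (i : ℕ) : gaussPoly i 0 = 1 := by
  cases i <;> simp [gaussPoly]

lemma gaussPoly_succ_succ (i c : ℕ) :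
    gaussPoly (i + 1) (c + 1) = gaussPoly (i + 1) c + X ^ (c + 1) * gaussPoly i (c + 1) := by
  rw [gaussPoly]

lemma gaussPoly_absorption (i c : ℕ) :
    (1 - X ^ (c + 1)) * gaussPoly i (c + 1) = (1 - X ^ (i + c + 1)) * gaussPoly i c ∧
      (1 - X ^ (i + 1)) * gaussPoly (i + 1) c = (1 - X ^ (i + c + 1)) * gaussPoly i c := by
  induction i generalizing c with
  | zero =>
    refine ⟨by simp [gaussPoly_zero_left], ?_⟩
    induction c with
    | zero => simp [gaussPoly_zero_right]
    | succ c ih =>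
      rw [gaussPoly_succ_succ]
      simp only [gaussPoly_zero_left] at ih ⊢
      linear_combination ih
  | succ i ih =>
    have hF : ∀ c, (1 - X ^ (c + 1)) * gaussPoly (i + 1) (c + 1) =
        (1 - X ^ (i + 1 + c + 1)) * gaussPoly (i + 1) c := fun c => by
      rw [gaussPoly_succ_succ]
      linear_combination X ^ (c + 1) * (ih c).1 - X ^ (c + 1) * (ih c).2
    refine ⟨hF c, ?_⟩
    induction c with
    | zero => simp [gaussPoly_zero_right]
    | succ c ihc =>
      rw [gaussPoly_succ_succ (i + 1) c]
      linear_combination ihc - hF c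

lemma gaussPoly_three_term (i c : ℕ) :
    gaussPoly (i + 1) (c + 1) = gaussPoly (i + 1) c + gaussPoly i (c + 1) +
      (X ^ (i + c + 1) - 1) * gaussPoly i c := by
  rw [gaussPoly_succ_succ]
  linear_combination -(gaussPoly_absorption i c).1

/-- The generating polynomial of `majStat` on binary sequences of length `n`. -/
noncomputable def galoisPoly (n : ℕ) : ℤ[X] :=
  ∑ σ : Fin n → Fin 2, X ^ majStat σ

lemma coeff_galoisPoly (n k : ℕ) :
    (galoisPoly n).coeff k =
      (((Finset.univ : Finset (Fin n → Fin 2)).filter (fun σ => majStat σ = k)).card : ℤ) := by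
  simp [galoisPoly, finsetSum_coeff, coeff_X_pow, eq_comm]

lemma majStat_snoc {n m : ℕ} (σ : Fin (n + 1) → Fin m) (x : Fin m) :
    majStat (Fin.snoc σ x : Fin (n + 2) → Fin m) =
      majStat σ + if x < σ (Fin.last n) then n + 1 else 0 := by
  have hc : ∀ (a : ℕ) (h : a < n + 1) (h' : a < n + 2),
      (Fin.snoc σ x : Fin (n + 2) → Fin m) ⟨a, h'⟩ = σ ⟨a, h⟩ := fun a h h' =>
    Fin.snoc_castSucc (α := fun _ => Fin m) x σ ⟨a, h⟩
  have hl : ∀ h' : n + 1 < n + 2,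
      (Fin.snoc σ x : Fin (n + 2) → Fin m) ⟨n + 1, h'⟩ = x := fun h' =>
    Fin.snoc_last (α := fun _ => Fin m) x σ
  unfold majStat
  rw [Fin.sum_univ_castSucc, Fin.sum_univ_castSucc, Fin.sum_univ_castSucc (n := n)]
  have h1 : ∀ a : Fin n, (a : ℕ) + 1 < n + 1 := fun a => by omega
  have h2 : ∀ a : Fin n, (a : ℕ) + 1 < n + 1 + 1 := fun a => by omega
  simp [hl, h1, h2, hc _ (h1 _), Fin.snoc_castSucc]

lemma majStat_snoc_one {n : ℕ} (σ : Fin n → Fin 2) :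
    majStat (Fin.snoc σ 1 : Fin (n + 1) → Fin 2) = majStat σ := by
  cases n with
  | zero => simp [majStat]
  | succ n =>
    rw [majStat_snoc, if_neg (by omega), add_zero]

lemma sum_snoc {n : ℕ} (f : (Fin (n + 1) → Fin 2) → ℤ[X]) :
    ∑ σ, f σ = ∑ τ : Fin n → Fin 2, (f (Fin.snoc τ 0) + f (Fin.snoc τ 1)) := by
  rw [← (Fin.snocEquiv (fun _ => Fin 2)).sum_comp, Fintype.sum_prod_type_right]
  simp [Fin.snocEquiv, Fin.sum_univ_two]

lemma galoisPoly_add_two (n : ℕ) :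
    galoisPoly (n + 2) = 2 * galoisPoly (n + 1) + (X ^ (n + 1) - 1) * galoisPoly n := by
  have h : galoisPoly (n + 2) - 2 * galoisPoly (n + 1) =
      ∑ σ : Fin (n + 1) → Fin 2,
        (X ^ (if 0 < σ (Fin.last n) then n + 1 else 0) - 1) * X ^ majStat σ := by
    rw [galoisPoly, sum_snoc, galoisPoly, Finset.mul_sum, ← Finset.sum_sub_distrib]
    refine Finset.sum_congr rfl fun σ _ => ?_
    rw [majStat_snoc_one, majStat_snoc, pow_add]
    ring
  rw [sum_snoc] at h
  simp only [Fin.snoc_last, majStat_snoc_one] at h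
  rw [← sub_eq_iff_eq_add', h, galoisPoly, Finset.mul_sum]
  simp

lemma sum_gaussPoly_add_two (n : ℕ) :
    ∑ x ∈ antidiagonal (n + 2), gaussPoly x.1 x.2 =
      2 * ∑ x ∈ antidiagonal (n + 1), gaussPoly x.1 x.2 +
        (X ^ (n + 1) - 1) * ∑ x ∈ antidiagonal n, gaussPoly x.1 x.2 := by
  have h : ∑ x ∈ antidiagonal n, gaussPoly (x.1 + 1) (x.2 + 1) =
      ∑ x ∈ antidiagonal n, gaussPoly (x.1 + 1) x.2 + ∑ x ∈ antidiagonal n, gaussPoly x.1 (x.2 + 1) +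
        (X ^ (n + 1) - 1) * ∑ x ∈ antidiagonal n, gaussPoly x.1 x.2 := by
    rw [Finset.mul_sum, ← Finset.sum_add_distrib, ← Finset.sum_add_distrib]
    refine Finset.sum_congr rfl fun x hx => ?_
    rw [gaussPoly_three_term, mem_antidiagonal.1 hx]
  have h1 := Finset.Nat.sum_antidiagonal_succ (n := n) (f := fun x => gaussPoly x.1 x.2)
  have h2 := Finset.Nat.sum_antidiagonal_succ' (n := n) (f := fun x => gaussPoly x.1 x.2)
  rw [Finset.Nat.sum_antidiagonal_succ, Finset.Nat.sum_antidiagonal_succ']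
  simp only [gaussPoly_zero_left, gaussPoly_zero_right] at h1 h2 ⊢
  linear_combination h - h1 - h2

lemma galoisPoly_eq_sum_gaussPoly (n : ℕ) :
    galoisPoly n = ∑ x ∈ antidiagonal n, gaussPoly x.1 x.2 := by
  induction n using Nat.twoStepInduction with
  | zero => simp [galoisPoly, majStat, gaussPoly_zero_left]
  | one =>
    rw [galoisPoly, sum_snoc]
    simp [majStat, Finset.Nat.antidiagonal_succ, gaussPoly_zero_left, gaussPoly_zero_right]
  | more n h0 h1 => rw [galoisPoly_add_two, sum_gaussPoly_add_two, h0, h1]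

lemma galoisPoly_succ_sub (n : ℕ) :
    galoisPoly (n + 1) - galoisPoly n =
      ∑ x ∈ antidiagonal n, X ^ x.2 * gaussPoly x.1 x.2 := by
  rw [galoisPoly_eq_sum_gaussPoly, galoisPoly_eq_sum_gaussPoly]
  cases n with
  | zero => simp [Finset.Nat.antidiagonal_succ, gaussPoly_zero_left, gaussPoly_zero_right]
  | succ n =>
    rw [Finset.Nat.sum_antidiagonal_succ, Finset.Nat.sum_antidiagonal_succ',
      Finset.Nat.sum_antidiagonal_succ,
      Finset.Nat.sum_antidiagonal_succ' (f := fun x => X ^ x.2 * gaussPoly x.1 x.2)]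
    simp only [gaussPoly_zero_left, gaussPoly_zero_right, gaussPoly_succ_succ, Finset.sum_add_distrib]
    ring

/-- The number of partitions of `k` with all parts at most `c`. -/
def boundedPartitionCount (c k : ℕ) : ℕ := #(Nat.Partition.restricted k (· ≤ c))

lemma boundedPartitionCount_zero_right (c : ℕ) : boundedPartitionCount c 0 = 1 := by
  simp [boundedPartitionCount, Nat.Partition.restricted]

lemma boundedPartitionCount_zero_succ (k : ℕ) : boundedPartitionCount 0 (k + 1) = 0 := by
  rw [boundedPartitionCount, Finset.card_eq_zero, Nat.Partition.restricted,
    Finset.filter_eq_empty_iff]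
  intro p _ hp
  have h : p.parts = 0 := Multiset.eq_zero_of_forall_notMem fun i hi =>
    absurd (hp i hi) (by have := p.parts_pos hi; omega)
  have := p.parts_sum
  simp [h] at this

lemma boundedPartitionCount_self (k : ℕ) :
    boundedPartitionCount k k = Fintype.card (Nat.Partition k) := by
  rw [boundedPartitionCount, Nat.Partition.restricted, Finset.filter_true_of_mem, Finset.card_univ]
  exact fun p _ i hi => p.le_of_mem_parts hi

lemma boundedPartitionCount_succ_of_lt {c k : ℕ} (h : k < c + 1) :
    boundedPartitionCount (c + 1) k = boundedPartitionCount c k := by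
  unfold boundedPartitionCount Nat.Partition.restricted
  congr 1
  refine Finset.filter_congr fun p _ => ?_
  refine forall₂_congr fun i hi => ?_
  have := p.le_of_mem_parts hi
  omega

lemma boundedPartitionCount_succ_of_le {c k : ℕ} (h : c + 1 ≤ k) :
    boundedPartitionCount (c + 1) k =
      boundedPartitionCount c k + boundedPartitionCount (c + 1) (k - (c + 1)) := by
  unfold boundedPartitionCount
  rw [← Finset.card_filter_add_card_filter_not (s := Nat.Partition.restricted k (· ≤ c + 1))
    (fun p => c + 1 ∉ p.parts)]
  congr 1
  · congr 1
    ext p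
    simp only [Nat.Partition.restricted, Finset.mem_filter, Finset.mem_univ, true_and]
    constructor
    · rintro ⟨h1, h2⟩ i hi
      have := h1 i hi
      have : i ≠ c + 1 := by rintro rfl; exact h2 hi
      omega
    · intro h1
      exact ⟨fun i hi => (h1 i hi).trans (by omega), fun h2 => absurd (h1 _ h2) (by omega)⟩
  · let e := Nat.Partition.partitionWithPartEquiv (Nat.succ_le_succ (Nat.zero_le c)) h
    symm
    refine Finset.card_bij (fun p _ => (e.symm p).1) ?_ ?_ ?_
    · intro p hp
      simp only [Nat.Partition.restricted, Finset.mem_filter, Finset.mem_univ, true_and,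
        not_not] at hp ⊢
      refine ⟨fun i hi => ?_, (e.symm p).2⟩
      rw [Nat.Partition.partitionWithPartEquiv_symm_apply_parts, Multiset.mem_cons] at hi
      rcases hi with rfl | hi
      · rfl
      · exact hp i hi
    · intro p _ q _ hpq
      exact e.symm.injective (Subtype.ext hpq)
    · intro p hp
      simp only [Nat.Partition.restricted, Finset.mem_filter, Finset.mem_univ, true_and,
        not_not] at hp
      refine ⟨e ⟨p, hp.2⟩, ?_, by simp⟩
      simp only [Nat.Partition.restricted, Finset.mem_filter, Finset.mem_univ, true_and]
      intro i hi
      rw [Nat.Partition.partitionWithPartEquiv_apply_parts] at hi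
      exact hp.1 i (Multiset.mem_of_mem_erase hi)

lemma coeff_gaussPoly {i m : ℕ} (c : ℕ) (h : m ≤ i) :
    (gaussPoly i c).coeff m = boundedPartitionCount c m := by
  induction i generalizing c m with
  | zero =>
    obtain rfl : m = 0 := by omega
    simp [gaussPoly_zero_left, boundedPartitionCount_zero_right]
  | succ i ih =>
    induction c with
    | zero =>
      rw [gaussPoly_zero_right]
      cases m with
      | zero => simp [boundedPartitionCount_zero_right]
      | succ m => simp [boundedPartitionCount_zero_succ, coeff_one]
    | succ c ihc =>
      rw [gaussPoly_succ_succ, coeff_add, ihc, coeff_X_pow_mul']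
      split_ifs with hc
      · rw [ih _ (by omega), boundedPartitionCount_succ_of_le hc]
        push_cast
        rfl
      · rw [boundedPartitionCount_succ_of_lt (by omega), add_zero]

lemma sum_boundedPartitionCount (n k : ℕ) :
    ∑ c ∈ range (n + 1), (if c ≤ k then boundedPartitionCount c (k - c) else 0) =
      boundedPartitionCount n k := by
  induction n with
  | zero => simp
  | succ n ih =>
    rw [Finset.sum_range_succ, ih]
    split_ifs with h
    · rw [boundedPartitionCount_succ_of_le h]
    · rw [boundedPartitionCount_succ_of_lt (by omega), add_zero]

lemma boundedPartitionCount_eq_card {n k : ℕ} (h : k ≤ n) :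
    boundedPartitionCount n k = Fintype.card (Nat.Partition k) := by
  induction n, h using Nat.le_induction with
  | base => exact boundedPartitionCount_self k
  | succ n hn ih => rw [boundedPartitionCount_succ_of_lt (by omega), ih]

/-- for `n ≥ k`, the coefficient of `q^k` in `G(n+1, 2) − G(n, 2)` — i.e.
`|{σ ∈ S(n+1,2) : maj σ = k}| − |{σ ∈ S(n,2) : maj σ = k}|` — equals the number of
integer partitions of `k`. -/
theorem stmt19 (n k : ℕ) (h : n ≥ k) :
    (((Finset.univ : Finset (Fin (n + 1) → Fin 2)).filter
        (fun σ => majStat σ = k)).card : ℤ) -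
      (((Finset.univ : Finset (Fin n → Fin 2)).filter
        (fun σ => majStat σ = k)).card : ℤ)
    = (Fintype.card (Nat.Partition k) : ℤ) := by
  rw [← coeff_galoisPoly, ← coeff_galoisPoly, ← coeff_sub, galoisPoly_succ_sub, finsetSum_coeff,
    ← boundedPartitionCount_eq_card h, ← sum_boundedPartitionCount,
    ← Finset.Nat.sum_antidiagonal_eq_sum_range_succ_mk
      (fun x => if x.1 ≤ k then boundedPartitionCount x.1 (k - x.1) else 0),
    ← Finset.Nat.sum_antidiagonal_swap]
  push_cast
  refine Finset.sum_congr rfl fun x hx => ?_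
  have hx' := mem_antidiagonal.1 hx
  simp only [Prod.fst_swap, Prod.snd_swap]
  rw [coeff_X_pow_mul']
  split_ifs with hk
  · exact coeff_gaussPoly _ (by omega)
  · rfl
end
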